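/- arXiv:1805.01816 — 5 statements merged into one kernel-verified Lean document; each statement's English description precedes it below -/
import Mathlib

section
/- Let K be a field, d ≥ 2, V a finite-dimensional K-vector space, and suppose q ∈ S^d V has strength S(q) ≤ k. Then there exist an integer ℓ ≤ k and a subspace W ⊆ V of dimension at most ℓ such that the image q̃ of q under the map S^d V → S^d(V/W) induced by the quotient map V → V/W satisfies S(⟨x, q̃⟩) ≤ 2(k − ℓ) for all x ∈ (V/W)^*, where ⟨·,·⟩: (V/W)^* × S^d(V/W) → S^{d−1}(V/W) denotes the natural contraction pairing (directional derivative). -/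
open MvPolynomial

noncomputable section

/-- A function `F : M → K` on a `K`-vector space `M` is a *polynomial function* if it lies in
the `K`-subalgebra of `M → K` generated by the linear functionals on `M`. -/
def IsPolyFun (K : Type) [Field K] {M : Type} [AddCommGroup M] [Module K M]
    (F : M → K) : Prop :=
  F ∈ Algebra.adjoin K (Set.range fun l : M →ₗ[K] K => (l : M → K))

/-- A subset of a finite-dimensional `K`-vector space `M` is *Zariski closed* if it is the
common zero locus of a collection of polynomial functions on `M`. -/
def IsZariskiClosed (K : Type) [Field K] {M : Type} [AddCommGroup M] [Module K M]
    (C : Set M) : Prop :=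
  ∃ S : Set (M → K), (∀ F ∈ S, IsPolyFun K F) ∧ C = {x | ∀ F ∈ S, F x = 0}

/-- `q ∈ S^d K^n` admits a strength decomposition with exactly `k` terms:
`q = r 0 * s 0 + ⋯ + r (k-1) * s (k-1)` with `r i` homogeneous of degree `e i ∈ {1, …, d-1}`
and `s i` homogeneous of degree `d - e i`. -/
def HasStrengthDecomp (K : Type) [Field K] (d : ℕ) {n : ℕ}
    (q : MvPolynomial (Fin n) K) (k : ℕ) : Prop :=
  ∃ (e : Fin k → ℕ) (r s : Fin k → MvPolynomial (Fin n) K),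
    (∀ i, 1 ≤ e i) ∧ (∀ i, e i ≤ d - 1) ∧
    (∀ i, (r i).IsHomogeneous (e i)) ∧
    (∀ i, (s i).IsHomogeneous (d - e i)) ∧
    q = ∑ i, r i * s i

/-- The strength of `q ∈ S^d K^n` is at most `N`. -/
def StrengthLe (K : Type) [Field K] (d : ℕ) {n : ℕ}
    (q : MvPolynomial (Fin n) K) (N : ℕ) : Prop :=
  ∃ k ≤ N, HasStrengthDecomp K d q k

/-- The algebra homomorphism `S φ : Sym(K^n) → Sym(K^m)` induced by a linear map
`φ : K^n → K^m`; it restricts to `S^d φ : S^d K^n → S^d K^m` in each degree. -/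
def polyMapAlg (K : Type) [Field K] {n m : ℕ} (φ : (Fin n → K) →ₗ[K] (Fin m → K)) :
    MvPolynomial (Fin n) K →ₐ[K] MvPolynomial (Fin m) K :=
  aeval fun i => ∑ j, φ (Pi.single i 1) j • X j

/-- A strength decomposition may be indexed by any finite type. -/
theorem strengthLe_card {K : Type} [Field K] {d n : ℕ} {ι : Type*} [Fintype ι]
    (e : ι → ℕ) (r s : ι → MvPolynomial (Fin n) K)
    (he : ∀ i, 1 ≤ e i) (hed : ∀ i, e i ≤ d - 1)
    (hr : ∀ i, (r i).IsHomogeneous (e i)) (hs : ∀ i, (s i).IsHomogeneous (d - e i)) :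
    StrengthLe K d (∑ i, r i * s i) (Fintype.card ι) := by
  let f := (Fintype.equivFin ι).symm
  exact ⟨_, le_rfl, e ∘ f, r ∘ f, s ∘ f, fun i => he _, fun i => hed _, fun i => hr _,
    fun i => hs _, (Equiv.sum_comp f fun i => r i * s i).symm⟩

theorem StrengthLe.mono {K : Type} [Field K] {d n N N' : ℕ} {q : MvPolynomial (Fin n) K}
    (h : StrengthLe K d q N) (hN : N ≤ N') : StrengthLe K d q N' :=
  let ⟨k, hk, hq⟩ := h
  ⟨k, hk.trans hN, hq⟩

/-- The directional derivative of a polynomial along a constant vector `c`. -/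
def directionalDeriv {K : Type} [Field K] {m : ℕ} (c : Fin m → K) :
    Derivation K (MvPolynomial (Fin m) K) (MvPolynomial (Fin m) K) :=
  ∑ i, c i • pderiv i

theorem directionalDeriv_apply {K : Type} [Field K] {m : ℕ} (c : Fin m → K)
    (p : MvPolynomial (Fin m) K) :
    directionalDeriv c p = ∑ i, c i • pderiv i p := by
  have h := map_sum Derivation.coeFnAddMonoidHom (fun i => c i • pderiv (R := K) i) Finset.univ
  exact (congrFun h p).trans (Finset.sum_apply _ _ _)

theorem MvPolynomial.IsHomogeneous.directionalDeriv {K : Type} [Field K] {m d : ℕ}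
    (c : Fin m → K) {p : MvPolynomial (Fin m) K} (hp : p.IsHomogeneous d) :
    (directionalDeriv c p).IsHomogeneous (d - 1) := by
  rw [directionalDeriv_apply]
  exact IsHomogeneous.sum _ _ _ fun i _ => by
    rw [smul_eq_C_mul]
    exact hp.pderiv.C_mul _

theorem MvPolynomial.IsHomogeneous.polyMapAlg {K : Type} [Field K] {n m d : ℕ}
    (φ : (Fin n → K) →ₗ[K] (Fin m → K)) {p : MvPolynomial (Fin n) K} (hp : p.IsHomogeneous d) :
    (polyMapAlg K φ p).IsHomogeneous d := by
  rw [← one_mul d]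
  refine hp.aeval _ fun i => IsHomogeneous.sum _ _ _ fun j _ => ?_
  rw [smul_eq_C_mul]
  exact isHomogeneous_C_mul_X _ _

/-- Differentiating a decomposition whose factors all have degree at least two at most doubles
the number of terms. -/
theorem strengthLe_directionalDeriv_sum {K : Type} [Field K] {d m : ℕ} {ι : Type*} [Fintype ι]
    (c : Fin m → K) (e : ι → ℕ) (r s : ι → MvPolynomial (Fin m) K)
    (he : ∀ i, 2 ≤ e i) (hed : ∀ i, e i + 2 ≤ d)
    (hr : ∀ i, (r i).IsHomogeneous (e i)) (hs : ∀ i, (s i).IsHomogeneous (d - e i)) :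
    StrengthLe K (d - 1) (directionalDeriv c (∑ i, r i * s i)) (2 * Fintype.card ι) := by
  have key := strengthLe_card (K := K) (d := d - 1) (ι := ι ⊕ ι)
    (Sum.elim (fun i => e i - 1) e)
    (Sum.elim (fun i => directionalDeriv c (r i)) r)
    (Sum.elim s fun i => directionalDeriv c (s i))
    (by rintro (i | i) <;> have := he i <;> simp <;> omega)
    (by rintro (i | i) <;> have := hed i <;> simp <;> omega)
    (by
      rintro (i | i)
      · exact (hr i).directionalDeriv c
      · exact hr i)
    (by
      rintro (i | i)
      · convert! hs i using 1
        have := he i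
        have := hed i
        simp only [Sum.elim_inl]
        omega
      · convert! (hs i).directionalDeriv c using 1
        simp only [Sum.elim_inr]
        omega)
  rw [Fintype.card_sum, ← two_mul] at key
  convert key using 1
  simp only [map_sum, Derivation.leibniz, smul_eq_mul, Fintype.sum_sum_type, Sum.elim_inl,
    Sum.elim_inr, ← Finset.sum_add_distrib]
  exact Finset.sum_congr rfl fun i _ => by ring

/-- A linear form is killed by `polyMapAlg K φ` once `φ` kills its coefficient vector. -/
theorem exists_vector_forall_polyMapAlg_eq_zero {K : Type} [Field K] {n : ℕ}
    {t : MvPolynomial (Fin n) K} (ht : t.IsHomogeneous 1) :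
    ∃ v : Fin n → K, ∀ (m : ℕ) (φ : (Fin n → K) →ₗ[K] (Fin m → K)),
      φ v = 0 → polyMapAlg K φ t = 0 := by
  rw [← mem_homogeneousSubmodule, homogeneousSubmodule_one_eq_span_X,
    Submodule.mem_span_range_iff_exists_fun] at ht
  obtain ⟨v, rfl⟩ := ht
  refine ⟨v, fun m φ hφ => ?_⟩
  have hv : ∀ j, ∑ i, v i * φ (Pi.single i 1) j = 0 := fun j => by
    rw [pi_eq_sum_univ' v, map_sum] at hφ
    simpa [Finset.sum_apply, Pi.single, Function.update] using congrFun hφ j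
  simp only [polyMapAlg, map_sum, map_smul, aeval_X, Finset.smul_sum, smul_smul]
  rw [Finset.sum_comm]
  simp [← Finset.sum_smul, hv]

/-- A finite family of vectors lies in the kernel of a surjection whose kernel has dimension at
most the size of the family. -/
theorem exists_surjective_finrank_ker_le {K : Type} [Field K] {n : ℕ} {ι : Type*} [Fintype ι]
    (v : ι → Fin n → K) :
    ∃ (m : ℕ) (π : (Fin n → K) →ₗ[K] (Fin m → K)), Function.Surjective π ∧
      Module.finrank K (LinearMap.ker π) ≤ Fintype.card ι ∧ ∀ i, π (v i) = 0 := by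
  let W := Submodule.span K (Set.range v)
  let b := (Module.finBasis K ((Fin n → K) ⧸ W)).equivFun
  have hker : LinearMap.ker (b.toLinearMap ∘ₗ W.mkQ) = W := by
    rw [LinearEquiv.ker_comp, Submodule.ker_mkQ]
  refine ⟨_, b.toLinearMap ∘ₗ W.mkQ, b.surjective.comp W.mkQ_surjective, ?_, fun i => ?_⟩
  · rw [hker]
    exact finrank_range_le_card v
  · rw [← LinearMap.mem_ker, hker]
    exact Submodule.subset_span ⟨i, rfl⟩

/-- **Lemma (`lm:Leibniz`).** Let `K` be a field, `d ≥ 2`, and `q ∈ S^d K^n` with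
`S(q) ≤ k`.  Then there are `ℓ ≤ k` and a subspace `W ⊆ K^n` of dimension at most `ℓ`
(presented here as the kernel of a surjective linear map `π : K^n → K^m` onto the quotient
`K^n/W ≅ K^m`) such that the image `q̃ = S^d π (q)` of `q` in `S^d (K^n/W)` satisfies
`S(⟨x, q̃⟩) ≤ 2(k - ℓ)` for every `x ∈ (K^n/W)^*`, where `⟨x, q̃⟩ = ∑ i, x_i ∂q̃/∂X_i` is the
natural contraction pairing `(K^n/W)^* × S^d(K^n/W) → S^{d-1}(K^n/W)`. -/
theorem exists_quotient_directional_derivatives_strengthLe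
    (K : Type) [Field K] (d : ℕ) (hd : 2 ≤ d) {n : ℕ}
    (q : MvPolynomial (Fin n) K) (hq : q.IsHomogeneous d)
    (k : ℕ) (hk : StrengthLe K d q k) :
    ∃ ℓ ≤ k, ∃ (m : ℕ) (π : (Fin n → K) →ₗ[K] (Fin m → K)),
      Function.Surjective π ∧
      Module.finrank K (LinearMap.ker π) ≤ ℓ ∧
      ∀ c : Fin m → K,
        StrengthLe K (d - 1)
          (∑ i, c i • MvPolynomial.pderiv i (polyMapAlg K π q)) (2 * (k - ℓ)) := by
  classical
  obtain ⟨N, hN, e, r, s, he, hed, hr, hs, rfl⟩ := hk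
  let p : Fin N → Prop := fun i => e i = 1 ∨ d - e i = 1
  have hlin : ∀ i : {i // p i}, ∃ v : Fin n → K,
      ∀ (m : ℕ) (φ : (Fin n → K) →ₗ[K] (Fin m → K)),
        φ v = 0 → polyMapAlg K φ (r i * s i) = 0 := by
    rintro ⟨i, hi | hi⟩
    · obtain ⟨v, hv⟩ := exists_vector_forall_polyMapAlg_eq_zero (hi ▸ hr i)
      exact ⟨v, fun m φ h => by rw [map_mul, hv m φ h, zero_mul]⟩
    · obtain ⟨v, hv⟩ := exists_vector_forall_polyMapAlg_eq_zero (hi ▸ hs i)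
      exact ⟨v, fun m φ h => by rw [map_mul, hv m φ h, mul_zero]⟩
  choose v hv using hlin
  obtain ⟨m, π, hπ, hker, hπv⟩ := exists_surjective_finrank_ker_le v
  have hcard : Fintype.card {i // p i} + Fintype.card {i // ¬ p i} = N := by
    rw [← Fintype.card_sum, Fintype.card_congr (Equiv.sumCompl p), Fintype.card_fin]
  refine ⟨Fintype.card {i // p i}, by omega, m, π, hπ, hker, fun c => ?_⟩
  have hsum : polyMapAlg K π (∑ i, r i * s i) =
      ∑ i : {i // ¬ p i}, polyMapAlg K π (r i) * polyMapAlg K π (s i) := by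
    rw [map_sum, ← Fintype.sum_subtype_add_sum_subtype p,
      Finset.sum_eq_zero fun i _ => hv i m π (hπv i), zero_add]
    simp only [map_mul]
  rw [← directionalDeriv_apply, hsum]
  have hdeg : ∀ i : {i // ¬ p i}, 2 ≤ e i ∧ e i + 2 ≤ d := fun i => by
    have := i.2
    have := he i
    have := hed i
    grind
  exact (strengthLe_directionalDeriv_sum c (fun i : {i // ¬ p i} => e i) _ _
    (fun i => (hdeg i).1) (fun i => (hdeg i).2) (fun i => (hr i).polyMapAlg π)
    (fun i => (hs i).polyMapAlg π)).mono (by omega)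

end
end

section
/- Let d ≥ 2 and for each n ≥ 1 let q_{d,n} := x_1^d + ⋯ + x_n^d ∈ S^d ℂ^n, where x_1,…,x_n is the standard basis of ℂ^n. Then S(q_{d,n}) → ∞ as n → ∞; that is, the sequence (S(q_{d,n}))_n is weakly increasing and unbounded. -/
open MvPolynomial

noncomputable section

/-- The strength `S(q)` of `q ∈ S^d K^n`: the minimal number of terms in a strength
decomposition of `q` (with the convention `S(0) = 0`). -/
def strength (K : Type) [Field K] (d : ℕ) {n : ℕ} (q : MvPolynomial (Fin n) K) : ℕ :=
  sInf {k | HasStrengthDecomp K d q k}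

/-- The endomorphism of `K[x_0, …, x_{n-1}]` killing the first `j` variables. -/
def killVars (K : Type) [Field K] (n j : ℕ) :
    MvPolynomial (Fin n) K →ₐ[K] MvPolynomial (Fin n) K :=
  aeval fun i => if i.1 < j then 0 else X i

theorem killVars_X (K : Type) [Field K] {n : ℕ} (j : ℕ) (i : Fin n) :
    killVars K n j (X i) = if i.1 < j then 0 else X i := by
  simp [killVars]

theorem killVars_comp_killVars (K : Type) [Field K] (n : ℕ) {j k : ℕ} (h : j ≤ k) :
    (killVars K n k).comp (killVars K n j) = killVars K n k := by
  refine algHom_ext fun i => ?_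
  rw [AlgHom.comp_apply, killVars_X]
  split_ifs with hi
  · rw [map_zero, killVars_X, if_pos (hi.trans_le h)]
  · rfl

theorem ker_killVars_lt (K : Type) [Field K] {n j : ℕ} (h : j < n) :
    RingHom.ker (killVars K n j) < RingHom.ker (killVars K n (j + 1)) := by
  refine lt_of_le_not_ge (fun p hp => ?_) fun hle => ?_
  · rw [RingHom.mem_ker] at hp ⊢
    rw [← killVars_comp_killVars K n j.le_succ, AlgHom.comp_apply, hp, map_zero]
  · have hX : X (⟨j, h⟩ : Fin n) ∈ RingHom.ker (killVars K n (j + 1)) := by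
      rw [RingHom.mem_ker, killVars_X, if_pos j.lt_succ_self]
    have hX' := hle hX
    rw [RingHom.mem_ker, killVars_X, if_neg (lt_irrefl j)] at hX'
    exact X_ne_zero _ hX'

theorem le_height_ker_killVars (K : Type) [Field K] {n j : ℕ} (h : j ≤ n) :
    (j : ℕ∞) ≤ (RingHom.ker (killVars K n j)).height := by
  induction j with
  | zero => simp
  | succ j ih =>
    have : (RingHom.ker (killVars K n j)).IsPrime := RingHom.ker_isPrime _
    have : (RingHom.ker (killVars K n (j + 1))).IsPrime := RingHom.ker_isPrime _
    push_cast
    exact (add_le_add_left (ih (Nat.le_of_succ_le h)) 1).trans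
      (Ideal.height_add_one_le_of_lt_of_isPrime (ker_killVars_lt K h))

theorem killVars_eq_zero_of_isHomogeneous {K : Type} [Field K] {n e : ℕ}
    {p : MvPolynomial (Fin n) K} (hp : p.IsHomogeneous e) (he : e ≠ 0) :
    killVars K n n p = 0 := by
  have h0 : constantCoeff p = 0 := by
    rw [constantCoeff_eq]
    exact hp.coeff_eq_zero (by simpa using he.symm)
  have hX : killVars K n n = aeval fun _ => 0 := by
    refine algHom_ext fun i => ?_
    rw [killVars_X, if_pos i.2, aeval_X]
  rw [hX, aeval_zero', h0, map_zero]

/-- A finite set of polynomials without constant term cutting out, set-theoretically, the origin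
of affine `n`-space has at least `n` elements. -/
theorem le_card_of_X_pow_mem_span {K : Type} [Field K] {n m : ℕ}
    (s : Finset (MvPolynomial (Fin n) K)) (hs : ∀ p ∈ s, killVars K n n p = 0)
    (hX : ∀ i, X i ^ m ∈ Ideal.span (s : Set (MvPolynomial (Fin n) K))) : n ≤ s.card := by
  have hprime : (RingHom.ker (killVars K n n)).IsPrime := RingHom.ker_isPrime _
  have hmin : RingHom.ker (killVars K n n) ∈
      (Ideal.span (s : Set (MvPolynomial (Fin n) K))).minimalPrimes := by
    refine ⟨⟨hprime, Ideal.span_le.2 hs⟩, fun J hJ _ p hp => ?_⟩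
    have hcomp : (Ideal.Quotient.mkₐ K J).comp (killVars K n n) = Ideal.Quotient.mkₐ K J := by
      refine algHom_ext fun i => ?_
      rw [AlgHom.comp_apply, killVars_X, if_pos i.2, map_zero]
      exact (Ideal.Quotient.eq_zero_iff_mem.2 (hJ.1.mem_of_pow_mem m (hJ.2 (hX i)))).symm
    have hpJ : Ideal.Quotient.mkₐ K J p = 0 := by
      rw [← hcomp, AlgHom.comp_apply, (RingHom.mem_ker).1 hp, map_zero]
    exact Ideal.Quotient.eq_zero_iff_mem.1 hpJ
  exact_mod_cast (le_height_ker_killVars K le_rfl).trans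
    (Ideal.height_le_card_of_mem_minimalPrimes_span_finset hmin)

/-- The partial derivatives of a power sum lie in the ideal generated by the factors of a strength
decomposition, so such a decomposition of `x_1^d + ⋯ + x_n^d` has at least `n / 2` terms. -/
theorem HasStrengthDecomp.le_two_mul {K : Type} [Field K] [CharZero K] {d n k : ℕ}
    (hd : 2 ≤ d) (h : HasStrengthDecomp K d (∑ i : Fin n, X i ^ d) k) : n ≤ 2 * k := by
  classical
  obtain ⟨e, r, s, he1, hed, hr, hs, hq⟩ := h
  let S : Finset (MvPolynomial (Fin n) K) := Finset.univ.image r ∪ Finset.univ.image s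
  have hcard : S.card ≤ 2 * k := by
    have h1 : (Finset.univ.image r).card ≤ k := Finset.card_image_le.trans (by simp)
    have h2 : (Finset.univ.image s).card ≤ k := Finset.card_image_le.trans (by simp)
    have h3 : S.card ≤ _ := Finset.card_union_le (Finset.univ.image r) (Finset.univ.image s)
    omega
  have hrS (i) : r i ∈ Ideal.span (S : Set (MvPolynomial (Fin n) K)) :=
    Ideal.subset_span (by simp [S])
  have hsS (i) : s i ∈ Ideal.span (S : Set (MvPolynomial (Fin n) K)) :=
    Ideal.subset_span (by simp [S])
  refine (le_card_of_X_pow_mem_span (m := d - 1) S (fun p hp => ?_) fun j => ?_).trans hcard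
  · simp only [S, Finset.mem_union, Finset.mem_image, Finset.mem_univ, true_and] at hp
    obtain ⟨i, rfl⟩ | ⟨i, rfl⟩ := hp
    · exact killVars_eq_zero_of_isHomogeneous (hr i) (by have := he1 i; omega)
    · exact killVars_eq_zero_of_isHomogeneous (hs i) (by have := hed i; omega)
  · have hderiv : pderiv j (∑ i : Fin n, (X i : MvPolynomial (Fin n) K) ^ d) =
        C (d : K) * X j ^ (d - 1) := by
      rw [map_sum, Finset.sum_eq_single j (fun i _ hij => ?_) (by simp)]
      · simp
      · rw [pderiv_pow, pderiv_X_of_ne hij, mul_zero]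
    have hmem : C (d : K) * X j ^ (d - 1) ∈ Ideal.span (S : Set (MvPolynomial (Fin n) K)) := by
      rw [← hderiv, hq, map_sum]
      refine Ideal.sum_mem _ fun i _ => ?_
      rw [pderiv_mul]
      exact add_mem (Ideal.mul_mem_left _ _ (hsS i)) (Ideal.mul_mem_right _ _ (hrS i))
    have hd0 : (d : K) ≠ 0 := Nat.cast_ne_zero.2 (by omega)
    have := Ideal.mul_mem_left _ (C (d : K)⁻¹) hmem
    rwa [← mul_assoc, ← C_mul, inv_mul_cancel₀ hd0, C_1, one_mul] at this

theorem hasStrengthDecomp_powerSum (K : Type) [Field K] {d : ℕ} (hd : 2 ≤ d) (n : ℕ) :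
    HasStrengthDecomp K d (∑ i : Fin n, X i ^ d) n := by
  refine ⟨fun _ => 1, X, fun i => X i ^ (d - 1), fun _ => le_rfl,
    fun _ => Nat.le_sub_of_add_le hd,
    fun i => isHomogeneous_X K i, fun i => isHomogeneous_X_pow i _, ?_⟩
  refine Finset.sum_congr rfl fun i _ => ?_
  rw [← pow_succ', Nat.sub_add_cancel (by omega)]

theorem hasStrengthDecomp_strength_powerSum (K : Type) [Field K] {d : ℕ} (hd : 2 ≤ d) (n : ℕ) :
    HasStrengthDecomp K d (∑ i : Fin n, X i ^ d)
      (strength K d (∑ i : Fin n, (X i : MvPolynomial (Fin n) K) ^ d)) :=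
  Nat.sInf_mem (s := {k | HasStrengthDecomp K d (∑ i : Fin n, X i ^ d) k})
    ⟨n, hasStrengthDecomp_powerSum K hd n⟩

/-- Strength decompositions are preserved by linear substitutions of the variables. -/
theorem HasStrengthDecomp.aeval {K : Type} [Field K] {d m n k : ℕ}
    {q : MvPolynomial (Fin n) K} (h : HasStrengthDecomp K d q k)
    (f : Fin n → MvPolynomial (Fin m) K) (hf : ∀ i, (f i).IsHomogeneous 1) :
    HasStrengthDecomp K d (MvPolynomial.aeval f q) k := by
  obtain ⟨e, r, s, he1, hed, hr, hs, rfl⟩ := h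
  refine ⟨e, fun i => MvPolynomial.aeval f (r i), fun i => MvPolynomial.aeval f (s i), he1, hed,
    fun i => ?_, fun i => ?_, by simp⟩
  · simpa using (hr i).aeval f hf
  · simpa using (hs i).aeval f hf

theorem HasStrengthDecomp.powerSum_succ {K : Type} [Field K] {d n k : ℕ}
    (hd : 2 ≤ d) (h : HasStrengthDecomp K d (∑ i : Fin (n + 1), X i ^ d) k) :
    HasStrengthDecomp K d (∑ i : Fin n, X i ^ d) k := by
  have hf : ∀ i, (Fin.snoc X 0 : Fin (n + 1) → MvPolynomial (Fin n) K) i |>.IsHomogeneous 1 :=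
    Fin.lastCases (by simpa using isHomogeneous_zero _ _ _)
      fun i => by simpa using isHomogeneous_X K i
  have hd0 : d ≠ 0 := by omega
  simpa [Fin.sum_univ_castSucc, hd0] using h.aeval _ hf

/-- **Example (power sums have unbounded strength).** Let `d ≥ 2` and
`q_{d,n} = x_1^d + ⋯ + x_n^d ∈ S^d ℂ^n`.  Then the sequence `(S(q_{d,n}))_n` is weakly
increasing and tends to infinity. -/
theorem strength_powerSum_monotone_tendsto_atTop (d : ℕ) (hd : 2 ≤ d) :
    Monotone (fun n => strength ℂ d (∑ i : Fin n, X i ^ d)) ∧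
    Filter.Tendsto (fun n => strength ℂ d (∑ i : Fin n, X i ^ d))
      Filter.atTop Filter.atTop := by
  refine ⟨monotone_nat_of_le_succ fun n => ?_, Filter.tendsto_atTop.2 fun b => ?_⟩
  · exact Nat.sInf_le ((hasStrengthDecomp_strength_powerSum ℂ hd (n + 1)).powerSum_succ hd)
  · filter_upwards [Filter.eventually_ge_atTop (2 * b)] with n hn
    have := (hasStrengthDecomp_strength_powerSum ℂ hd n).le_two_mul hd
    omega

end
end

section
/- Let K be an infinite field and fix integers d ≥ 2 and k ≥ 0. Then there exists n_0 such that for all n ≥ n_0, the set of elements of S^d K^n of strength at most k is not Zariski-dense in S^d K^n; equivalently, its Zariski closure Y_{d,k}(K^n) is a proper closed subset of S^d K^n. (This follows because the dimension of Y_{d,k}(K^n) is bounded by a polynomial of degree d − 1 in n, while dim S^d K^n is a polynomial of degree d in n.) -/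
open MvPolynomial

noncomputable section

/-- Monomials of degree `d` in `n` variables are counted by multisets of size `d`. -/
theorem natCard_degree_eq (n d : ℕ) :
    Nat.card {m : Fin n →₀ ℕ // m.degree = d} = n.multichoose d := by
  have e : Sym (Fin n) d ≃ {m : Fin n →₀ ℕ // m.degree = d} := Sym.equivNatSum (Fin n) d
  rw [← Nat.card_congr e, Nat.card_eq_fintype_card, Sym.card_sym_eq_multichoose, Fintype.card_fin]

/-- Homogenization bounds the number of monomials of degree at most `d` in `n` variables. -/
theorem natCard_degree_le (n d : ℕ) :
    Nat.card {m : Fin n →₀ ℕ // m.degree ≤ d} ≤ (n + 1).multichoose d := by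
  let f : {m : Fin n →₀ ℕ // m.degree ≤ d} → Sym (Option (Fin n)) d := fun m =>
    ⟨(Finsupp.toMultiset m.1).map some + Multiset.replicate (d - m.1.degree) none, by
      have h : Multiset.card (Finsupp.toMultiset m.1) = m.1.degree := Finsupp.card_toMultiset _
      simp only [Multiset.card_add, Multiset.card_map, Multiset.card_replicate, h]
      have := m.2
      omega⟩
  have hf : Function.Injective f := by
    intro a b h
    have h' := congrArg Subtype.val h
    apply Subtype.ext
    ext i
    have hi := congrArg (Multiset.count (some i)) h'
    simpa [f, Multiset.count_add, Multiset.count_replicate,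
      Multiset.count_map_eq_count' _ _ (Option.some_injective _)] using hi
  refine (Nat.card_le_card_of_injective f hf).trans ?_
  rw [Nat.card_eq_fintype_card, Sym.card_sym_eq_multichoose]
  simp

theorem mul_natCard_degree_lt {n d k : ℕ} (hd : 1 ≤ d) (hn : k * d < n) :
    k * Nat.card {m : Fin n →₀ ℕ // m.degree ≤ d - 1} <
      Nat.card {m : Fin n →₀ ℕ // m.degree = d} := by
  obtain ⟨j, rfl⟩ : ∃ j, d = j + 1 := ⟨d - 1, by omega⟩
  rw [natCard_degree_eq]
  refine (Nat.mul_le_mul_left k (natCard_degree_le n j)).trans_lt ?_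
  rw [Nat.multichoose_eq, Nat.multichoose_eq]
  have h := Nat.choose_succ_right_eq (n + j) j
  rw [Nat.add_sub_cancel] at h
  have hpos : 0 < (n + j).choose j := Nat.choose_pos (by omega)
  rw [show n + 1 + j - 1 = n + j by omega, show n + (j + 1) - 1 = n + j by omega]
  refine Nat.lt_of_mul_lt_mul_right (a := j + 1) ?_
  rw [h]
  calc k * (n + j).choose j * (j + 1) = (n + j).choose j * (k * (j + 1)) := by ring
    _ < _ := Nat.mul_lt_mul_of_pos_left hn hpos

/-- More polynomials than variables satisfy a nontrivial algebraic relation. -/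
theorem exists_aeval_eq_zero_of_natCard_lt {K ι τ : Type} [Field K] [Finite ι] [Finite τ]
    (F : ι → MvPolynomial τ K) (h : Nat.card τ < Nat.card ι) :
    ∃ G : MvPolynomial ι K, G ≠ 0 ∧ aeval F G = 0 := by
  have hF : ¬ AlgebraicIndependent K F := fun hF => by
    have hle := hF.cardinalMk_le_trdeg
    rw [MvPolynomial.trdeg_of_isDomain, Cardinal.lift_id, ← Nat.cast_card, ← Nat.cast_card] at hle
    exact h.not_ge (by exact_mod_cast hle)
  rw [algebraicIndependent_iff] at hF
  push Not at hF
  obtain ⟨G, hG, hG0⟩ := hF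
  exact ⟨G, hG0, hG⟩

theorem isPolyFun_eval {K ι M : Type} [Field K] [AddCommGroup M] [Module K M]
    (l : ι → M →ₗ[K] K) (G : MvPolynomial ι K) :
    IsPolyFun K fun x : M => eval (fun i => l i x) G := by
  unfold IsPolyFun
  induction G using MvPolynomial.induction_on with
  | C a =>
    simp only [eval_C]
    exact Subalgebra.algebraMap_mem _ a
  | add p q hp hq =>
    simp only [map_add]
    exact Subalgebra.add_mem _ hp hq
  | mul_X p i hp =>
    simp only [map_mul, eval_X]
    exact Subalgebra.mul_mem _ hp (Algebra.subset_adjoin ⟨l i, rfl⟩)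

section GenericPolynomial

variable {K σ τ : Type} [Field K] {B : Type} [Fintype B]

/-- The polynomial with support in the family `b` whose coefficients are the variables `v`. -/
def genericPolynomial (K : Type) [Field K] (b : B → σ →₀ ℕ) (v : B → τ) :
    MvPolynomial σ (MvPolynomial τ K) :=
  ∑ a, monomial (b a) (X (v a))

theorem map_eval_genericPolynomial {p : (σ →₀ ℕ) → Prop} [Fintype {m // p m}]
    (v : {m // p m} → τ) (c : τ → K) (r : MvPolynomial σ K)
    (hc : ∀ a, c (v a) = coeff a.1 r) (hr : ∀ m, coeff m r ≠ 0 → p m) :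
    map (eval c) (genericPolynomial K Subtype.val v) = r := by
  classical
  ext m
  simp only [genericPolynomial, map_sum, map_monomial, eval_X, hc, coeff_sum, coeff_monomial]
  by_cases hm : p m
  · rw [Finset.sum_eq_single ⟨m, hm⟩]
    · simp
    · rintro a - ha
      exact if_neg fun h => ha (Subtype.ext h)
    · simp
  · rw [Finset.sum_eq_zero]
    · by_contra h
      exact hm (hr m (Ne.symm h))
    · rintro a -
      exact if_neg fun h : a.1 = m => hm (h ▸ a.2)

end GenericPolynomial

/-- An element of strength at most `k` is a sum of exactly `k` products of polynomials whose
monomials have degree at most `d - 1`. -/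
theorem StrengthLe.exists_eq_sum {K : Type} [Field K] {d n k : ℕ}
    {q : MvPolynomial (Fin n) K} (h : StrengthLe K d q k) :
    ∃ r : Fin k × Bool → MvPolynomial (Fin n) K,
      (∀ i m, coeff m (r i) ≠ 0 → m.degree ≤ d - 1) ∧
      q = ∑ i, r (i, true) * r (i, false) := by
  obtain ⟨l, hl, e, r, s, he1, hed, hr, hs, rfl⟩ := h
  obtain ⟨t, rfl⟩ := Nat.exists_eq_add_of_le hl
  refine ⟨fun i => Fin.addCases (fun j => if i.2 then r j else s j) (fun _ => 0) i.1, ?_, ?_⟩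
  · rintro ⟨i, b⟩ m
    refine Fin.addCases (fun j => ?_) (fun j => ?_) i
    · simp only [Fin.addCases_left]
      have h1 := he1 j
      have h2 := hed j
      cases b
      · intro hm
        have : m.degree = d - e j :=
          (DFunLike.congr_fun Finsupp.degree_eq_weight_one m).trans (hs j (by simpa using hm))
        omega
      · intro hm
        have : m.degree = e j :=
          (DFunLike.congr_fun Finsupp.degree_eq_weight_one m).trans (hr j (by simpa using hm))
        omega
    · simp
  · simp [Fin.sum_univ_add]

/-- **Example (`ex:Strength`).** Let `K` be an infinite field, `d ≥ 2` and `k ≥ 0`.  For all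
sufficiently large `n`, the set of elements of `S^d K^n` of strength at most `k` is not
Zariski dense in `S^d K^n`: its Zariski closure `Y_{d,k}(K^n)` is a proper closed subset,
i.e. it is contained in some Zariski closed set `C ⊊ S^d K^n`. -/
theorem strengthLe_not_dense
    (K : Type) [Field K] [Infinite K] (d : ℕ) (hd : 2 ≤ d) (k : ℕ) :
    ∃ n₀ : ℕ, ∀ n ≥ n₀,
      ∃ C : Set (homogeneousSubmodule (Fin n) K d),
        IsZariskiClosed K C ∧
        {q : homogeneousSubmodule (Fin n) K d |
          StrengthLe K d (q : MvPolynomial (Fin n) K) k} ⊆ C ∧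
        C ≠ Set.univ := by
  refine ⟨2 * k * d + 1, fun n hn => ?_⟩
  have : Finite {m : Fin n →₀ ℕ // m.degree ≤ d - 1} := Finsupp.finite_of_degree_le (d - 1)
  have : Finite {m : Fin n →₀ ℕ // m.degree = d} := Finsupp.finite_of_degree_eq d
  have := Fintype.ofFinite {m : Fin n →₀ ℕ // m.degree ≤ d - 1}
  have := Fintype.ofFinite {m : Fin n →₀ ℕ // m.degree = d}
  let P (i : Fin k × Bool) := genericPolynomial K
    (Subtype.val : {m : Fin n →₀ ℕ // m.degree ≤ d - 1} → _) (fun a => (i, a))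
  have hcard : Nat.card ((Fin k × Bool) × {m : Fin n →₀ ℕ // m.degree ≤ d - 1}) <
      Nat.card {m : Fin n →₀ ℕ // m.degree = d} := by
    have h := mul_natCard_degree_lt (n := n) (d := d) (k := 2 * k) (by omega) (by omega)
    rw [Nat.card_prod, Nat.card_prod]
    simpa [mul_comm] using h
  obtain ⟨G, hG0, hG⟩ := exists_aeval_eq_zero_of_natCard_lt
    (fun m : {m : Fin n →₀ ℕ // m.degree = d} =>
      coeff m.1 (∑ i, P (i, true) * P (i, false))) hcard
  let l (m : {m : Fin n →₀ ℕ // m.degree = d}) : homogeneousSubmodule (Fin n) K d →ₗ[K] K :=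
    lcoeff K m.1 ∘ₗ Submodule.subtype _
  refine ⟨{q | eval (fun m => l m q) G = 0},
    ⟨{fun q => eval (fun m => l m q) G}, ?_, by simp⟩, ?_, fun huniv => hG0 ?_⟩
  · rintro _ rfl
    exact isPolyFun_eval l G
  · rintro ⟨q, hqd⟩ hq
    obtain ⟨r, hr, hqr⟩ := StrengthLe.exists_eq_sum hq
    let c : (Fin k × Bool) × {m : Fin n →₀ ℕ // m.degree ≤ d - 1} → K :=
      fun x => coeff x.2.1 (r x.1)
    have hP (i : Fin k × Bool) : map (eval c) (P i) = r i :=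
      map_eval_genericPolynomial _ c (r i) (fun _ => rfl) (hr i)
    have hcoeff (m : {m : Fin n →₀ ℕ // m.degree = d}) :
        eval c (coeff m.1 (∑ i, P (i, true) * P (i, false))) = coeff m.1 q := by
      simp only [← coeff_map, map_sum, map_mul, hP, ← hqr]
    have h0 := congrArg (aeval c) hG
    rw [MvPolynomial.comp_aeval_apply, map_zero] at h0
    simp only [aeval_eq_eval, hcoeff] at h0
    exact h0
  · refine MvPolynomial.funext fun x => ?_
    have hmem : ∑ m : {m : Fin n →₀ ℕ // m.degree = d}, monomial m.1 (x m) ∈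
        homogeneousSubmodule (Fin n) K d :=
      Submodule.sum_mem _ fun m _ => isHomogeneous_monomial _ m.2
    have h := huniv.ge (Set.mem_univ ⟨_, hmem⟩)
    have hx (m : {m : Fin n →₀ ℕ // m.degree = d}) : l m ⟨_, hmem⟩ = x m := by
      classical
      simp [l, lcoeff, coeff_sum, coeff_monomial, Subtype.val_inj]
    simpa [hx] using h

end
end

section
/- Let K be a field, d ≥ 2, and V a finite-dimensional K-vector space with dim V ≥ d. Then every q ∈ Λ^d V has strength S(q) ≤ dim V − d + 1; in fact every q ∈ Λ^d V can be written as a sum of at most dim V − d + 1 terms of the form r ∧ s with r ∈ Λ^1 V = V and s ∈ Λ^{d−1} V. -/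
noncomputable section

/-- `q ∈ Λ^d M` admits a strength decomposition with exactly `k` terms:
`q = r 0 ∧ s 0 + ⋯ + r (k-1) ∧ s (k-1)` with `r i ∈ Λ^{e i} M`, `s i ∈ Λ^{d - e i} M`, and
`e i ∈ {1, …, d-1}`.  (The wedge product is the product of the exterior algebra.) -/
def ExtDecomp (K : Type) [Field K] (d : ℕ) {M : Type} [AddCommGroup M] [Module K M]
    (q : ExteriorAlgebra K M) (k : ℕ) : Prop :=
  ∃ (e : Fin k → ℕ) (r s : Fin k → ExteriorAlgebra K M),
    (∀ i, 1 ≤ e i) ∧ (∀ i, e i ≤ d - 1) ∧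
    (∀ i, r i ∈ ⋀[K]^(e i) M) ∧ (∀ i, s i ∈ ⋀[K]^(d - e i) M) ∧
    q = ∑ i, r i * s i

/-- The strength of an alternating tensor `q ∈ Λ^d M` is at most `N`. -/
def ExtStrengthLe (K : Type) [Field K] (d : ℕ) {M : Type} [AddCommGroup M] [Module K M]
    (q : ExteriorAlgebra K M) (N : ℕ) : Prop :=
  ∃ k ≤ N, ExtDecomp K d q k

/-- The first value of a strictly increasing map `Fin (m + 1) → Fin n` is less than `n - m`. -/
lemma Fin.val_apply_zero_add_lt_of_strictMono {m n : ℕ} {f : Fin (m + 1) → Fin n}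
    (hf : StrictMono f) : (f 0 : ℕ) + m < n := by
  have key : ∀ i : Fin (m + 1), (f 0 : ℕ) + i ≤ f i := by
    intro i
    induction i using Fin.induction with
    | zero => simp
    | succ i ih =>
      have h : f i.castSucc < f i.succ := hf i.castSucc_lt_succ
      rw [Fin.lt_def] at h
      simp only [Fin.val_castSucc, Fin.val_succ] at ih ⊢
      omega
  have h := key (Fin.last m)
  have h' := (f (Fin.last m)).isLt
  simp only [Fin.val_last] at h
  omega

/-- If `v 0, …, v (n - 1)` span `M`, then every element of `Λ^(m + 1) M` is a sum of products
`v j ∧ s j` with `j < n - m` and `s j ∈ Λ^m M`. -/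
lemma exteriorPower.exists_eq_sum_ι_mul {R M : Type*} [CommRing R] [AddCommGroup M] [Module R M]
    {m n : ℕ} {v : Fin n → M} (hv : Submodule.span R (Set.range v) = ⊤)
    {q : ExteriorAlgebra R M} (hq : q ∈ ⋀[R]^(m + 1) M) :
    ∃ s : Fin (n - m) → ExteriorAlgebra R M, (∀ j, s j ∈ ⋀[R]^m M) ∧
      q = ∑ j, ExteriorAlgebra.ι R (v (j.castLE (Nat.sub_le n m))) * s j := by
  rw [← exteriorPower.ιMulti_family_span_fixedDegree_of_span R hv] at hq
  induction hq using Submodule.span_induction with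
  | mem x hx =>
    obtain ⟨t, rfl⟩ := hx
    set f := Set.powersetCard.ofFinEmbEquiv.symm t
    have hf := Fin.val_apply_zero_add_lt_of_strictMono f.strictMono
    let j : Fin (n - m) := ⟨f 0, by omega⟩
    refine ⟨Pi.single j (ExteriorAlgebra.ιMulti R m (fun i => v (f i.succ))), fun i => ?_, ?_⟩
    · rw [Pi.single_apply]
      split_ifs
      · exact ExteriorAlgebra.ιMulti_range R m ⟨_, rfl⟩
      · exact zero_mem _
    · rw [Finset.sum_eq_single j (fun i _ hi => by simp [Pi.single_eq_of_ne hi]) (by simp),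
        Pi.single_eq_same]
      exact ExteriorAlgebra.ιMulti_succ_apply _
  | zero => exact ⟨0, fun _ => zero_mem _, by simp⟩
  | add x y _ _ hx hy =>
    obtain ⟨s, hs, rfl⟩ := hx
    obtain ⟨t, ht, rfl⟩ := hy
    exact ⟨s + t, fun j => add_mem (hs j) (ht j), by simp [mul_add, Finset.sum_add_distrib]⟩
  | smul a x _ hx =>
    obtain ⟨s, hs, rfl⟩ := hx
    exact ⟨a • s, fun j => Submodule.smul_mem _ a (hs j), by simp [Finset.smul_sum]⟩

/-- **Bound by the dimension.** Let `K` be a field, `d ≥ 2`, and `V = K^n` with `n ≥ d`.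
Every `q ∈ Λ^d V` has strength at most `n - d + 1`; in fact `q` can be written as a sum of
at most `n - d + 1` terms of the form `r ∧ s` with `r ∈ Λ^1 V = V` and `s ∈ Λ^{d-1} V`. -/
theorem extStrengthLe_dim (K : Type) [Field K] (d : ℕ) (hd : 2 ≤ d) {n : ℕ} (hn : d ≤ n)
    (q : ExteriorAlgebra K (Fin n → K)) (hq : q ∈ ⋀[K]^d (Fin n → K)) :
    ExtStrengthLe K d q (n - d + 1) ∧
    ∃ k ≤ n - d + 1, ∃ (r : Fin k → (Fin n → K)) (s : Fin k → ExteriorAlgebra K (Fin n → K)),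
      (∀ i, s i ∈ ⋀[K]^(d - 1) (Fin n → K)) ∧
      q = ∑ i, ExteriorAlgebra.ι K (r i) * s i := by
  obtain ⟨m, rfl⟩ : ∃ m, d = m + 1 := ⟨d - 1, by omega⟩
  obtain ⟨s, hs, hqs⟩ := exteriorPower.exists_eq_sum_ι_mul (Pi.basisFun K (Fin n)).span_eq hq
  have hk : n - m ≤ n - (m + 1) + 1 := by omega
  refine ⟨⟨n - m, hk, fun _ => 1, _, s, fun _ => le_rfl, fun _ => by dsimp only; omega, fun j => ?_, hs, hqs⟩,
    n - m, hk, _, s, hs, hqs⟩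
  simp only [pow_one]
  exact LinearMap.mem_range_self _ _

end
end

section
/- Let K be a field, d ≥ 2, and let U_1,…,U_d and V_1,…,V_d be finite-dimensional K-vector spaces. For q ∈ (U_1 ⊕ V_1) ⊗ ⋯ ⊗ (U_d ⊕ V_d), write q = Σ_{J ⊆ [d]} q_J according to the decomposition into summands ⊗_{j ∉ J} U_j ⊗ ⊗_{j ∈ J} V_j, so that q_{[d]} ∈ V_1 ⊗ ⋯ ⊗ V_d. Then S(q) ≤ dim U_1 + ⋯ + dim U_d + S(q_{[d]}). -/
noncomputable section

/-- We identify `T^d(K^{n 0}, …, K^{n (d-1)}) = K^{n 0} ⊗ ⋯ ⊗ K^{n (d-1)}` with the space of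
`d`-way arrays `(∀ j, Fin (n j)) → K`.  A tensor `q` admits a strength decomposition with
exactly `k` terms if `q = r 0 ⊗ s 0 + ⋯ + r (k-1) ⊗ s (k-1)` where `r i ∈ ⊗_{j ∈ J i} V_j`
and `s i ∈ ⊗_{j ∉ J i} V_j` for non-empty proper subsets `J i ⊊ {0, …, d-1}`. -/
def TensorDecomp (K : Type) [Field K] {d : ℕ} {n : Fin d → ℕ}
    (q : (∀ j, Fin (n j)) → K) (k : ℕ) : Prop :=
  ∃ (J : Fin k → Set (Fin d))
    (r : ∀ i, (∀ j : (J i), Fin (n j)) → K)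
    (s : ∀ i, (∀ j : ↥(J i)ᶜ, Fin (n j)) → K),
    (∀ i, (J i).Nonempty) ∧ (∀ i, J i ≠ Set.univ) ∧
    ∀ a : ∀ j, Fin (n j), q a = ∑ i, r i (fun j => a j) * s i (fun j => a j)

/-- The strength `S(q)` of the tensor `q`: the minimal number of terms in a strength
decomposition of `q` (with the convention `S(0) = 0`). -/
def tensorStrength (K : Type) [Field K] {d : ℕ} {n : Fin d → ℕ}
    (q : (∀ j, Fin (n j)) → K) : ℕ :=
  sInf {k | TensorDecomp K q k}

/-- A strength decomposition indexed by a finite type, whose factors are given as functions of the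
full multi-index depending only on the coordinates in `J i` and in its complement. -/
theorem tensorDecomp_card_of_dependsOn {K : Type} [Field K] {d : ℕ} {n : Fin d → ℕ}
    {q : (∀ j, Fin (n j)) → K} {ι : Type*} [Fintype ι] (J : ι → Set (Fin d))
    (f g : ι → (∀ j, Fin (n j)) → K) (hne : ∀ i, (J i).Nonempty) (huniv : ∀ i, J i ≠ Set.univ)
    (hf : ∀ i, DependsOn (f i) (J i)) (hg : ∀ i, DependsOn (g i) (J i)ᶜ)
    (hq : ∀ a, q a = ∑ i, f i a * g i a) :
    TensorDecomp K q (Fintype.card ι) := by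
  choose r hr using fun i => dependsOn_iff_exists_comp.1 (hf i)
  choose s hs using fun i => dependsOn_iff_exists_comp.1 (hg i)
  let e := (Fintype.equivFin ι).symm
  refine ⟨fun i => J (e i), fun i => r (e i), fun i => s (e i), fun i => hne _,
    fun i => huniv _, fun a => ?_⟩
  rw [hq, ← Equiv.sum_comp e]
  refine Finset.sum_congr rfl fun i _ => ?_
  rw [hr, hs]
  rfl

theorem Set.singleton_ne_univ_of_two_le {d : ℕ} (hd : 2 ≤ d) (j : Fin d) :
    ({j} : Set (Fin d)) ≠ Set.univ := by
  have : Nontrivial (Fin d) := Fin.nontrivial_iff_two_le.2 hd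
  exact Set.singleton_ne_univ j

/-- Slicing along the first factor shows that every tensor has a strength decomposition. -/
theorem exists_tensorDecomp (K : Type) [Field K] {d : ℕ} (hd : 2 ≤ d) {n : Fin d → ℕ}
    (q : (∀ j, Fin (n j)) → K) : ∃ k, TensorDecomp K q k := by
  let j : Fin d := ⟨0, by omega⟩
  refine ⟨_, tensorDecomp_card_of_dependsOn (ι := Fin (n j)) (fun _ => {j})
    (fun x a => if a j = x then 1 else 0) (fun x a => q (Function.update a j x))
    (fun _ => Set.singleton_nonempty j) (fun _ => Set.singleton_ne_univ_of_two_le hd j)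
    (fun x a b hab => ?_) (fun x a b hab => ?_) fun a => ?_⟩
  · simp only [hab j rfl]
  · refine congrArg q (funext fun i => ?_)
    by_cases hi : i = j
    · subst hi; simp
    · simpa [hi] using hab i hi
  · simp

/-- The decomposition obtained by splitting off the slices indexed by the `U_j`, each multi-index
being charged to the first coordinate at which it lies in the `U`-range. -/
theorem TensorDecomp.of_corner {K : Type} [Field K] {d : ℕ} (hd : 2 ≤ d) {u n : Fin d → ℕ}
    {q : (∀ j, Fin (u j + n j)) → K} {k : ℕ}
    (h : TensorDecomp K (fun b : ∀ j, Fin (n j) => q fun j => Fin.natAdd (u j) (b j)) k) :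
    TensorDecomp K q ((∑ j, u j) + k) := by
  classical
  obtain ⟨J, r, s, hne, huniv, hq⟩ := h
  let shift (S : Set (Fin d)) (b : ∀ j : S, Fin (n j)) (j : S) : Fin (u j + n j) :=
    Fin.natAdd (u j) (b j)
  have shift_injective (S : Set (Fin d)) : Function.Injective (shift S) := fun b c hbc =>
    funext fun j => Fin.natAdd_injective _ _ (congrFun hbc j)
  have extend_eq_zero (S : Set (Fin d)) (F : (∀ j : S, Fin (n j)) → K)
      (a : ∀ j, Fin (u j + n j)) (j : Fin d) (hj : j ∈ S) (haj : (a j : ℕ) < u j) :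
      Function.extend (shift S) F 0 (fun j : S => a j) = 0 := by
    refine Function.extend_apply' _ _ _ ?_
    rintro ⟨b, hb⟩
    have : u j + (b ⟨j, hj⟩ : ℕ) = a j := congrArg Fin.val (congrFun hb ⟨j, hj⟩)
    omega
  have key := tensorDecomp_card_of_dependsOn (q := q) (ι := (Σ j, Fin (u j)) ⊕ Fin k)
    (Sum.elim (fun p => {p.1}) J)
    (Sum.elim (fun p a => if a p.1 = Fin.castAdd _ p.2 then 1 else 0)
      fun i a => Function.extend (shift (J i)) (r i) 0 fun j : J i => a j)
    (Sum.elim (fun p a => if ∀ i < p.1, u i ≤ a i then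
        q (Function.update a p.1 (Fin.castAdd _ p.2)) else 0)
      fun i a => Function.extend (shift (J i)ᶜ) (s i) 0 fun j : ↥(J i)ᶜ => a j)
    ?_ ?_ ?_ ?_ ?_
  · simpa using key
  · rintro (p | i)
    exacts [Set.singleton_nonempty _, hne i]
  · rintro (p | i)
    exacts [Set.singleton_ne_univ_of_two_le hd _, huniv i]
  · rintro (p | i) a b hab
    · simp only [Sum.elim_inl, hab p.1 rfl]
    · exact congrArg (Function.extend (shift (J i)) (r i) 0)
        (funext fun j => hab j j.2)
  · rintro (p | i) a b hab
    · have hlt : (∀ i < p.1, u i ≤ a i) ↔ ∀ i < p.1, u i ≤ b i :=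
        forall₂_congr fun i hi => by rw [hab i hi.ne]
      have hupd : Function.update a p.1 (Fin.castAdd _ p.2) =
          Function.update b p.1 (Fin.castAdd _ p.2) := funext fun i => by
        by_cases hi : i = p.1
        · subst hi; simp
        · simpa [hi] using hab i hi
      simp only [Sum.elim_inl, hlt, hupd]
    · exact congrArg (Function.extend (shift (J i)ᶜ) (s i) 0)
        (funext fun j => hab j j.2)
  · intro a
    rw [Fintype.sum_sum_type]
    simp only [Sum.elim_inl, Sum.elim_inr]
    by_cases ha : ∃ j, (a j : ℕ) < u j
    · obtain ⟨j, hj, hmin⟩ := wellFounded_lt.has_min {j | (a j : ℕ) < u j} ha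
      have hj : (a j : ℕ) < u j := hj
      have hcast : a j = Fin.castAdd (n j) ⟨a j, hj⟩ := rfl
      rw [Finset.sum_eq_single ⟨j, ⟨a j, hj⟩⟩, Finset.sum_eq_zero, add_zero]
      · rw [if_pos hcast, if_pos fun i hi => not_lt.1 fun h => hmin i h hi, ← hcast,
          Function.update_eq_self, one_mul]
      · intro i _
        by_cases hi : j ∈ J i
        · rw [extend_eq_zero _ _ a j hi hj, zero_mul]
        · rw [extend_eq_zero (J i)ᶜ _ a j hi hj, mul_zero]
      · rintro ⟨i, x⟩ - hp
        by_cases hx : a i = Fin.castAdd (n i) x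
        · have hai : (a i : ℕ) < u i := by rw [hx]; exact x.2
          have hij : i ≠ j := by
            rintro rfl
            exact hp (by congr; exact Fin.ext (by simp [hx]))
          have hji : j < i := lt_of_le_of_ne (not_lt.1 (hmin i hai)) hij.symm
          rw [if_neg (c := ∀ l < i, u l ≤ a l) fun h => (h j hji).not_gt hj, mul_zero]
        · rw [if_neg hx, zero_mul]
      · simp
    · push Not at ha
      obtain ⟨b, rfl⟩ : ∃ b : ∀ j, Fin (n j), a = fun j => Fin.natAdd (u j) (b j) :=
        ⟨fun j => ⟨a j - u j, by have := (a j).2; have := ha j; omega⟩,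
          funext fun j => Fin.ext (by have := ha j; simp; omega)⟩
      rw [Finset.sum_eq_zero, zero_add]
      · refine (hq b).trans ?_
        refine Finset.sum_congr rfl fun i _ => ?_
        exact congrArg₂ (· * ·) ((shift_injective _).extend_apply (r i) 0 _).symm
          ((shift_injective _).extend_apply (s i) 0 _).symm
      · rintro ⟨i, x⟩ -
        rw [if_neg, zero_mul]
        intro h
        have := congrArg Fin.val h
        simp only [Fin.val_natAdd, Fin.val_castAdd] at this
        omega

/-- **Lemma (`lm:TensorChopping`).** Let `K` be a field, `d ≥ 2`, `U_j = K^{u j}` and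
`V_j = K^{n j}`.  For `q ∈ (U_1 ⊕ V_1) ⊗ ⋯ ⊗ (U_d ⊕ V_d)` with component decomposition
`q = ∑_{J ⊆ [d]} q_J`, `q_J ∈ ⊗_{j ∉ J} U_j ⊗ ⊗_{j ∈ J} V_j`, one has
`S(q) ≤ dim U_1 + ⋯ + dim U_d + S(q_{[d]})`.  Here `U_j ⊕ V_j = K^{u j + n j}` in array
coordinates, and the component `q_{[d]} ∈ V_1 ⊗ ⋯ ⊗ V_d` is the subarray of `q` where every
index lies in the `V`-range. -/
theorem tensorStrength_le_sum_dim_add_tensorStrength_corner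
    (K : Type) [Field K] {d : ℕ} (hd : 2 ≤ d) {u n : Fin d → ℕ}
    (q : (∀ j, Fin (u j + n j)) → K) :
    tensorStrength K q ≤ (∑ j, u j) +
      tensorStrength K (fun b : ∀ j, Fin (n j) => q fun j => Fin.natAdd (u j) (b j)) := by
  exact Nat.sInf_le (TensorDecomp.of_corner hd (Nat.sInf_mem (exists_tensorDecomp K hd _)))

end
end
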